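/- arXiv:2108.06442 — 9 statements merged into one kernel-verified Lean document; each statement's English description precedes it below -/
import Mathlib

section
/- Consider the restricted reduced Chaplygin-beanie dynamics. Suppose (r, w, φ, α) : [0, ∞) → ℝ⁴ is a differentiable solution of the system r' = γ3·w², w' = λ2·r·w − ν0·(ν1·φ + ν3·r·w), φ' = α, α' = ν1·φ + ν3·r·w, with initial conditions r(0) = 0, w(0) = 0, α(0) = 0, and φ(0) = φ₀ ≠ 0 (the system starting at rest with a nonzero initial rotor deflection). Then there exists r_∞ > 0 such that r(t) → r_∞ as t → ∞, and there exist constants K > 0 and λ > 0 such that |w(t)| ≤ K·exp(−λ·t), |φ(t)| ≤ K·exp(−λ·t), and |α(t)| ≤ K·exp(−λ·t) for all t ≥ 0. -/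
open Real Filter

theorem antitoneOn_Ici_of_hasDerivAt_nonpos {f f' : ℝ → ℝ} {s : ℝ}
    (hf : ∀ t ≥ s, HasDerivAt f (f' t) t) (hf' : ∀ t ≥ s, f' t ≤ 0) :
    AntitoneOn f (Set.Ici s) := by
  refine antitoneOn_of_hasDerivWithinAt_nonpos (f' := f') (convex_Ici s)
    (fun t ht => (hf t ht).continuousAt.continuousWithinAt) (fun t ht => ?_) (fun t ht => ?_)
  · exact (hf t (interior_subset ht)).hasDerivWithinAt
  · exact hf' t (interior_subset ht)

theorem monotoneOn_Ici_of_hasDerivAt_nonneg {f f' : ℝ → ℝ} {s : ℝ}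
    (hf : ∀ t ≥ s, HasDerivAt f (f' t) t) (hf' : ∀ t ≥ s, 0 ≤ f' t) :
    MonotoneOn f (Set.Ici s) := by
  have h := antitoneOn_Ici_of_hasDerivAt_nonpos (f := fun t => -f t) (f' := fun t => -f' t)
    (fun t ht => (hf t ht).neg) (fun t ht => neg_nonpos.2 (hf' t ht))
  intro x hx y hy hxy
  exact neg_le_neg_iff.1 (h hx hy hxy)

/-- A function satisfying `f' ≤ -c * f` on `[s, ∞)` decays at least like `exp (-c * t)`. -/
theorem mul_exp_le_of_hasDerivAt_le {f f' : ℝ → ℝ} {s c : ℝ}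
    (hf : ∀ t ≥ s, HasDerivAt f (f' t) t) (hf' : ∀ t ≥ s, f' t ≤ -c * f t) :
    ∀ t ≥ s, f t * exp (c * t) ≤ f s * exp (c * s) := by
  intro t ht
  have hder : ∀ x ≥ s, HasDerivAt (fun x => f x * exp (c * x))
      (f' x * exp (c * x) + f x * (exp (c * x) * (c * 1))) x := fun x hx =>
    (hf x hx).mul (((hasDerivAt_id x).const_mul c).exp)
  refine antitoneOn_Ici_of_hasDerivAt_nonpos hder (fun x hx => ?_) Set.self_mem_Ici ht ht
  nlinarith [hf' x hx, exp_pos (c * x)]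

set_option maxHeartbeats 1000000 in
/-- The quadratic form `(w + ν α)² + q (α² + n φ²)`, perturbed by small cross terms, is a strict
Lyapunov function for the linear system `w' = -(L + ν b) r w + ν n φ`, `φ' = α`,
`α' = -n φ + b r w`, uniformly for `r` in a compact interval of positive numbers. -/
theorem exists_strict_lyapunov {L ν b n q ρ₀ ρ₁ : ℝ} (hL : 0 < L) (hν : 0 < ν)
    (hn : 0 < n) (hq : 0 < q) (hρ₀ : 0 < ρ₀) :
    ∃ ε c₁ c₂ μ : ℝ, 0 < c₁ ∧ 0 < c₂ ∧ 0 < μ ∧ ∀ w φ α : ℝ,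
      c₁ * (w ^ 2 + φ ^ 2 + α ^ 2) ≤
        (w + ν * α) ^ 2 + q * (α ^ 2 + n * φ ^ 2) - ε * (w * φ + ν / 2 * (φ * α)) ∧
      (w + ν * α) ^ 2 + q * (α ^ 2 + n * φ ^ 2) - ε * (w * φ + ν / 2 * (φ * α)) ≤
        c₂ * (w ^ 2 + φ ^ 2 + α ^ 2) ∧
      ∀ r, ρ₀ ≤ r → r ≤ ρ₁ →
        -2 * L * r * w ^ 2 - ε * ((-(L + ν * b) * r * w + ν * n * φ) * φ + w * α
          + ν / 2 * (α * α + φ * (-n * φ + b * r * w))) ≤ -μ * (w ^ 2 + φ ^ 2 + α ^ 2) := by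
  set κ : ℝ := 2 + (2 * ν ^ 2 + 1) / q + 1 / (q * n) with hκ
  have hκ0 : 0 < κ := by positivity
  set G : ℝ := ((L + ν * b / 2) * ρ₁) ^ 2 / (ν * n) + 1 / ν with hG
  have hG0 : 0 < G := by positivity
  set ε : ℝ := min (1 / (2 * κ * (1 + ν))) (L * ρ₀ / G) with hε
  have hε0 : 0 < ε := by positivity
  have hε1 : ε * (1 + ν) ≤ 1 / (2 * κ) := by
    have : ε ≤ 1 / (2 * κ * (1 + ν)) := min_le_left _ _
    calc ε * (1 + ν) ≤ 1 / (2 * κ * (1 + ν)) * (1 + ν) := by gcongr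
      _ = 1 / (2 * κ) := by field_simp
  have hε2 : ε * G ≤ L * ρ₀ := by
    have : ε ≤ L * ρ₀ / G := min_le_right _ _
    rwa [le_div_iff₀ hG0] at this
  set μ : ℝ := min (L * ρ₀) (min (ε * ν * n / 4) (ε * ν / 4)) with hμ
  refine ⟨ε, 1 / (2 * κ), 2 + 2 * ν ^ 2 + q + q * n + ε * (1 + ν), μ, by positivity,
    by positivity, by positivity, fun w φ α => ?_⟩
  have hcross : |w * φ + ν / 2 * (φ * α)| ≤ (1 + ν) * (w ^ 2 + φ ^ 2 + α ^ 2) := by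
    rw [abs_le]
    constructor <;>
    nlinarith [sq_nonneg (w + φ), sq_nonneg (w - φ), mul_nonneg hν.le (sq_nonneg (φ + α)),
      mul_nonneg hν.le (sq_nonneg (φ - α)), mul_nonneg hν.le (sq_nonneg w),
      mul_nonneg hν.le (sq_nonneg φ), mul_nonneg hν.le (sq_nonneg α), sq_nonneg w,
      sq_nonneg φ, sq_nonneg α]
  have hcross' : |ε * (w * φ + ν / 2 * (φ * α))| ≤
      ε * (1 + ν) * (w ^ 2 + φ ^ 2 + α ^ 2) := by
    rw [abs_mul, abs_of_pos hε0, mul_assoc]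
    gcongr
  have hV : w ^ 2 + φ ^ 2 + α ^ 2 ≤ κ * ((w + ν * α) ^ 2 + q * (α ^ 2 + n * φ ^ 2)) := by
    have h1 : κ * ((w + ν * α) ^ 2 + q * (α ^ 2 + n * φ ^ 2)) =
        2 * (w + ν * α) ^ 2 + (2 * ν ^ 2 + 1) * α ^ 2 + φ ^ 2
        + (2 * (q * (α ^ 2 + n * φ ^ 2)) + (2 * ν ^ 2 + 1) * n * φ ^ 2 + α ^ 2 / n
          + ((2 * ν ^ 2 + 1) / q + 1 / (q * n)) * (w + ν * α) ^ 2) := by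
      rw [hκ]; field_simp; ring
    have h2 : 0 ≤ 2 * (q * (α ^ 2 + n * φ ^ 2)) + (2 * ν ^ 2 + 1) * n * φ ^ 2 + α ^ 2 / n
          + ((2 * ν ^ 2 + 1) / q + 1 / (q * n)) * (w + ν * α) ^ 2 := by positivity
    nlinarith [sq_nonneg (w + 2 * ν * α)]
  refine ⟨?_, ?_, fun r hr₀ hr₁ => ?_⟩
  · have h1 : 1 / κ * (w ^ 2 + φ ^ 2 + α ^ 2) ≤
        (w + ν * α) ^ 2 + q * (α ^ 2 + n * φ ^ 2) := by
      rw [one_div, inv_mul_le_iff₀ hκ0]; exact hV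
    have h2 : 1 / κ = 1 / (2 * κ) + 1 / (2 * κ) := by field_simp; norm_num
    have h3 : ε * (1 + ν) * (w ^ 2 + φ ^ 2 + α ^ 2) ≤
        1 / (2 * κ) * (w ^ 2 + φ ^ 2 + α ^ 2) := by gcongr
    rw [h2, add_mul] at h1
    linarith [(abs_le.1 hcross').2]
  · have h1 : (w + ν * α) ^ 2 ≤ 2 * w ^ 2 + 2 * ν ^ 2 * α ^ 2 := by
      nlinarith [sq_nonneg (w - ν * α)]
    have h2 : 0 ≤ 2 * (φ ^ 2 + α ^ 2) + 2 * ν ^ 2 * (w ^ 2 + φ ^ 2)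
      + q * (w ^ 2 + φ ^ 2) + q * n * (w ^ 2 + α ^ 2) := by positivity
    have h3 : (2 + 2 * ν ^ 2 + q + q * n + ε * (1 + ν)) * (w ^ 2 + φ ^ 2 + α ^ 2) =
        2 * w ^ 2 + 2 * ν ^ 2 * α ^ 2 + q * (α ^ 2 + n * φ ^ 2)
        + (2 * (φ ^ 2 + α ^ 2) + 2 * ν ^ 2 * (w ^ 2 + φ ^ 2)
          + q * (w ^ 2 + φ ^ 2) + q * n * (w ^ 2 + α ^ 2))
        + ε * (1 + ν) * (w ^ 2 + φ ^ 2 + α ^ 2) := by ring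
    linarith [(abs_le.1 hcross').1]
  · have hr : 0 < r := hρ₀.trans_le hr₀
    set c : ℝ := (L + ν * b / 2) * r with hc
    have hc2 : c ^ 2 ≤ ((L + ν * b / 2) * ρ₁) ^ 2 := by
      rw [hc, mul_pow, mul_pow]; gcongr
    have hwφ : c * (w * φ) ≤ ν * n / 4 * φ ^ 2 +
        ((L + ν * b / 2) * ρ₁) ^ 2 / (ν * n) * w ^ 2 := by
      have h1 : c * (w * φ) ≤ ν * n / 4 * φ ^ 2 + c ^ 2 / (ν * n) * w ^ 2 := by
        have : ν * n / 4 * φ ^ 2 + c ^ 2 / (ν * n) * w ^ 2 - c * (w * φ) =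
            (ν * n * φ / 2 - c * w) ^ 2 / (ν * n) := by field_simp; ring
        have h0 : 0 ≤ (ν * n * φ / 2 - c * w) ^ 2 / (ν * n) := by positivity
        linarith
      have h2 : c ^ 2 / (ν * n) * w ^ 2 ≤
          ((L + ν * b / 2) * ρ₁) ^ 2 / (ν * n) * w ^ 2 := by gcongr
      linarith
    have hwα : -(w * α) ≤ ν / 4 * α ^ 2 + 1 / ν * w ^ 2 := by
      have : ν / 4 * α ^ 2 + 1 / ν * w ^ 2 + w * α = (ν * α / 2 + w) ^ 2 / ν := by
        field_simp; ring
      have h0 : 0 ≤ (ν * α / 2 + w) ^ 2 / ν := by positivity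
      linarith
    have hsum : ε * (c * (w * φ) - w * α) ≤
        ε * (ν * n / 4 * φ ^ 2 + ν / 4 * α ^ 2 + G * w ^ 2) := by
      refine mul_le_mul_of_nonneg_left ?_ hε0.le
      rw [hG]; linarith
    have hGw : ε * G * w ^ 2 ≤ L * ρ₀ * w ^ 2 := by gcongr
    have hrw : L * ρ₀ * w ^ 2 ≤ L * r * w ^ 2 := by gcongr
    have hμ1 : μ * w ^ 2 ≤ L * ρ₀ * w ^ 2 := by gcongr; exact min_le_left _ _
    have hμ2 : μ * φ ^ 2 ≤ ε * ν * n / 4 * φ ^ 2 := by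
      gcongr; exact (min_le_right _ _).trans (min_le_left _ _)
    have hμ3 : μ * α ^ 2 ≤ ε * ν / 4 * α ^ 2 := by
      gcongr; exact (min_le_right _ _).trans (min_le_right _ _)
    have heq : -2 * L * r * w ^ 2 - ε * ((-(L + ν * b) * r * w + ν * n * φ) * φ + w * α
          + ν / 2 * (α * α + φ * (-n * φ + b * r * w))) =
        -2 * (L * r * w ^ 2) + ε * (c * (w * φ) - w * α)
          - 2 * (ε * ν * n / 4 * φ ^ 2) - 2 * (ε * ν / 4 * α ^ 2) := by
      rw [hc]; ring
    rw [heq]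
    linarith

theorem abs_le_mul_exp_of_sq_le {x A lam t : ℝ} (hA : 0 ≤ A)
    (h : x ^ 2 * exp (lam * t) ≤ A) : |x| ≤ (A + 1) * exp (-(lam / 2) * t) := by
  refine abs_le_of_sq_le_sq ?_ (by positivity)
  have he : exp (lam * t) * exp (-(lam / 2) * t) ^ 2 = 1 := by
    rw [← exp_nat_mul, ← exp_add, exp_eq_one_iff]; push_cast; ring
  have h2 : x ^ 2 = x ^ 2 * exp (lam * t) * exp (-(lam / 2) * t) ^ 2 := by
    rw [mul_assoc, he, mul_one]
  rw [h2, mul_pow]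
  gcongr
  nlinarith

/-- Relaxation of `r' = g w²`, `w' = -(L + ν b) r w + ν n φ`, `φ' = α`, `α' = -n φ + b r w` with
positive coefficients, started at rest with `φ 0 ≠ 0`. -/
theorem tendsto_and_exp_decay_of_relaxation_system {g L ν b n : ℝ} (hg : 0 < g) (hL : 0 < L)
    (hν : 0 < ν) (hb : 0 < b) (hn : 0 < n) {r w φ α : ℝ → ℝ}
    (hr : ∀ t ≥ (0 : ℝ), HasDerivAt r (g * w t ^ 2) t)
    (hw : ∀ t ≥ (0 : ℝ), HasDerivAt w (-(L + ν * b) * r t * w t + ν * n * φ t) t)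
    (hφ : ∀ t ≥ (0 : ℝ), HasDerivAt φ (α t) t)
    (hα : ∀ t ≥ (0 : ℝ), HasDerivAt α (-n * φ t + b * r t * w t) t)
    (hr0 : r 0 = 0) (hφ0 : φ 0 ≠ 0) :
    (∃ rinf : ℝ, 0 < rinf ∧ Tendsto r atTop (nhds rinf)) ∧
      ∃ K : ℝ, 0 < K ∧ ∃ lam : ℝ, 0 < lam ∧ ∀ t ≥ (0 : ℝ),
        |w t| ≤ K * exp (-lam * t) ∧ |φ t| ≤ K * exp (-lam * t) ∧
        |α t| ≤ K * exp (-lam * t) := by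
  have hmono : MonotoneOn r (Set.Ici 0) :=
    monotoneOn_Ici_of_hasDerivAt_nonneg hr (fun t _ => by positivity)
  have hr_nonneg : ∀ t ≥ (0 : ℝ), 0 ≤ r t := fun t ht =>
    hr0 ▸ hmono Set.self_mem_Ici ht ht
  have hr1 : 0 < r 1 := by
    by_contra! hneg
    have hrz : ∀ t ∈ Set.Ioo (0 : ℝ) 1, r t = 0 := fun t ht =>
      le_antisymm ((hmono (Set.mem_Ici.2 ht.1.le) (Set.mem_Ici.2 zero_le_one) ht.2.le).trans hneg)
        (hr_nonneg t ht.1.le)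
    have hwz : ∀ t ∈ Set.Ioo (0 : ℝ) 1, w t = 0 := by
      intro t ht
      have h0 : HasDerivAt r 0 t := (hasDerivAt_const t (0 : ℝ)).congr_of_eventuallyEq
        (Filter.eventually_of_mem (isOpen_Ioo.mem_nhds ht) hrz)
      have := (hr t ht.1.le).unique h0
      simpa [hg.ne'] using this
    have hφz : ∀ t ∈ Set.Ioo (0 : ℝ) 1, φ t = 0 := by
      intro t ht
      have h0 : HasDerivAt w 0 t := (hasDerivAt_const t (0 : ℝ)).congr_of_eventuallyEq
        (Filter.eventually_of_mem (isOpen_Ioo.mem_nhds ht) hwz)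
      have := (hw t ht.1.le).unique h0
      simpa [hwz t ht, hν.ne', hn.ne'] using this
    have hlim : Tendsto φ (nhdsWithin 0 (Set.Ioi 0)) (nhds (φ 0)) :=
      (hφ 0 le_rfl).continuousAt.tendsto.mono_left nhdsWithin_le_nhds
    refine hφ0 (tendsto_nhds_unique_of_eventuallyEq hlim tendsto_const_nhds ?_)
    exact Filter.eventually_of_mem (Ioo_mem_nhdsGT zero_lt_one) hφz
  obtain ⟨q, hq⟩ : ∃ q, q = L * ν / b := ⟨_, rfl⟩
  have hq0 : 0 < q := by rw [hq]; positivity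
  have hqb : q * b = L * ν := by rw [hq]; field_simp
  have hVder : ∀ t ≥ (0 : ℝ), HasDerivAt
      (fun t => (w t + ν * α t) ^ 2 + q * (α t ^ 2 + n * φ t ^ 2)) (-2 * L * r t * w t ^ 2) t := by
    intro t ht
    refine ((((hw t ht).add ((hα t ht).const_mul ν)).pow 2).add
      ((((hα t ht).pow 2).add (((hφ t ht).pow 2).const_mul n)).const_mul q)).congr_deriv ?_
    simp only [Pi.add_apply]
    push_cast
    linear_combination (2 * α t * r t * w t) * hqb
  obtain ⟨R, hR⟩ : ∃ R, ∀ t ≥ (0 : ℝ), r t ≤ R := by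
    have hEder : ∀ t ≥ (0 : ℝ), HasDerivAt (fun t => (w t + ν * α t) ^ 2
        + q * (α t ^ 2 + n * φ t ^ 2) + L / g * r t ^ 2) 0 t := by
      intro t ht
      refine ((hVder t ht).add (((hr t ht).pow 2).const_mul (L / g))).congr_deriv ?_
      field_simp
      push_cast
      ring
    have hE := antitoneOn_Ici_of_hasDerivAt_nonpos hEder (fun _ _ => le_rfl)
    set E := (w 0 + ν * α 0) ^ 2 + q * (α 0 ^ 2 + n * φ 0 ^ 2) + L / g * r 0 ^ 2 with hEdef
    refine ⟨E / (L / g) + 1, fun t ht => ?_⟩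
    have h1 : (w t + ν * α t) ^ 2 + q * (α t ^ 2 + n * φ t ^ 2) + L / g * r t ^ 2 ≤ E :=
      hE Set.self_mem_Ici ht ht
    have h2 : 0 ≤ (w t + ν * α t) ^ 2 + q * (α t ^ 2 + n * φ t ^ 2) := by positivity
    have h3 : r t ^ 2 ≤ E / (L / g) := by
      rw [le_div_iff₀ (by positivity)]; linarith
    nlinarith [sq_nonneg (r t - 1)]
  constructor
  · have hmono' : Monotone (fun t => r (max t 0)) := fun x y hxy =>
      hmono (Set.mem_Ici.2 (le_max_right x 0)) (Set.mem_Ici.2 (le_max_right y 0))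
        (max_le_max_right 0 hxy)
    have hlim := tendsto_atTop_ciSup hmono'
      ⟨R, by rintro _ ⟨t, rfl⟩; exact hR _ (le_max_right t 0)⟩
    have hlim' : Tendsto r atTop (nhds (⨆ t, r (max t 0))) := by
      refine hlim.congr' ?_
      filter_upwards [eventually_ge_atTop 0] with t ht
      rw [max_eq_left ht]
    refine ⟨_, hr1.trans_le (ge_of_tendsto hlim' ?_), hlim'⟩
    filter_upwards [eventually_ge_atTop 1] with t ht
    exact hmono (Set.mem_Ici.2 zero_le_one) (Set.mem_Ici.2 (zero_le_one.trans ht)) ht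
  · obtain ⟨ε, c₁, c₂, μ, hc₁, hc₂, hμ, hW⟩ :=
      exists_strict_lyapunov (b := b) (ρ₁ := R) hL hν hn hq0 hr1
    set W : ℝ → ℝ := fun t => (w t + ν * α t) ^ 2 + q * (α t ^ 2 + n * φ t ^ 2)
      - ε * (w t * φ t + ν / 2 * (φ t * α t)) with hWdef
    have hWder : ∀ t ≥ (0 : ℝ), HasDerivAt W (-2 * L * r t * w t ^ 2
        - ε * ((-(L + ν * b) * r t * w t + ν * n * φ t) * φ t + w t * α t
          + ν / 2 * (α t * α t + φ t * (-n * φ t + b * r t * w t)))) t := fun t ht =>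
      (hVder t ht).sub ((((hw t ht).mul (hφ t ht)).add
        (((hφ t ht).mul (hα t ht)).const_mul (ν / 2))).const_mul ε)
    have hdecay : ∀ t ≥ (1 : ℝ), W t * exp (μ / c₂ * t) ≤ W 1 * exp (μ / c₂ * 1) := by
      refine mul_exp_le_of_hasDerivAt_le
        (fun t ht => hWder t (zero_le_one.trans ht)) (fun t ht => ?_)
      have ht0 : (0 : ℝ) ≤ t := zero_le_one.trans ht
      obtain ⟨-, h2, h3⟩ := hW (w t) (φ t) (α t)
      refine (h3 (r t) (hmono (Set.mem_Ici.2 zero_le_one) (Set.mem_Ici.2 ht0) ht)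
        (hR t ht0)).trans ?_
      have h4 : μ / c₂ * W t ≤ μ / c₂ * (c₂ * (w t ^ 2 + φ t ^ 2 + α t ^ 2)) := by
        gcongr
      have h5 : μ / c₂ * (c₂ * (w t ^ 2 + φ t ^ 2 + α t ^ 2)) =
          μ * (w t ^ 2 + φ t ^ 2 + α t ^ 2) := by field_simp
      linarith
    have hcont : ContinuousOn (fun t => W t * exp (μ / c₂ * t)) (Set.Icc 0 1) := by
      refine ContinuousOn.mul
        (fun t ht => (hWder t ht.1).continuousAt.continuousWithinAt) (by fun_prop)
    obtain ⟨A, hA⟩ := (isCompact_Icc.bddAbove_image hcont)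
    have hbound : ∀ t ≥ (0 : ℝ), W t * exp (μ / c₂ * t) ≤ A := by
      intro t ht
      rcases le_total t 1 with h | h
      · exact hA ⟨t, ⟨ht, h⟩, rfl⟩
      · exact (hdecay t h).trans (hA ⟨1, ⟨zero_le_one, le_rfl⟩, rfl⟩)
    have hN : ∀ t ≥ (0 : ℝ),
        (w t ^ 2 + φ t ^ 2 + α t ^ 2) * exp (μ / c₂ * t) ≤ A / c₁ := by
      intro t ht
      rw [le_div_iff₀ hc₁]
      have h1 : c₁ * (w t ^ 2 + φ t ^ 2 + α t ^ 2) * exp (μ / c₂ * t) ≤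
          W t * exp (μ / c₂ * t) := by
        gcongr
        exact (hW (w t) (φ t) (α t)).1
      linarith [hbound t ht]
    have hA0 : 0 ≤ A / c₁ := le_trans (by positivity) (hN 0 le_rfl)
    refine ⟨A / c₁ + 1, by positivity, μ / c₂ / 2, by positivity, fun t ht => ?_⟩
    refine ⟨abs_le_mul_exp_of_sq_le hA0 (le_trans ?_ (hN t ht)),
      abs_le_mul_exp_of_sq_le hA0 (le_trans ?_ (hN t ht)),
      abs_le_mul_exp_of_sq_le hA0 (le_trans ?_ (hN t ht))⟩ <;>
    · gcongr
      nlinarith [sq_nonneg (w t), sq_nonneg (φ t), sq_nonneg (α t)]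

/-- For the restricted reduced Chaplygin-beanie dynamics starting at rest
with nonzero rotor deflection, `r` tends to a positive limit and `w`, `φ`, `α` decay
exponentially. -/
theorem chaplygin_passive_stable_trajectory
    (m M a B C k : ℝ)
    (hm : 0 < m) (hM : 0 < M) (ha : 0 < a) (hB : 0 < B) (hC : 0 < C) (hk : 0 < k)
    (d γ3 lam2 ν0 D ν1 ν3 : ℝ)
    (hd : d = m * (B + C) + M * (m * a ^ 2 + B + C))
    (hγ3 : γ3 = m * M * a * (m + M) / d)
    (hl2 : lam2 = -a * (m + M))
    (hν0 : ν0 = B / d)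
    (hD : D = B * (m * M * a ^ 2 + C * (m + M)))
    (hν1 : ν1 = -d * k / D)
    (hν3 : ν3 = a * B * (m + M) ^ 2 / (d * D))
    (r w φ α : ℝ → ℝ)
    (hr : ∀ t ≥ (0 : ℝ), HasDerivAt r (γ3 * (w t) ^ 2) t)
    (hw : ∀ t ≥ (0 : ℝ),
      HasDerivAt w (lam2 * r t * w t - ν0 * (ν1 * φ t + ν3 * r t * w t)) t)
    (hφ : ∀ t ≥ (0 : ℝ), HasDerivAt φ (α t) t)
    (hα : ∀ t ≥ (0 : ℝ), HasDerivAt α (ν1 * φ t + ν3 * r t * w t) t)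
    (hr0 : r 0 = 0) (hw0 : w 0 = 0) (hα0 : α 0 = 0)
    (φ0 : ℝ) (hφinit : φ 0 = φ0) (hφ0ne : φ0 ≠ 0) :
    (∃ rinf : ℝ, 0 < rinf ∧ Tendsto r atTop (nhds rinf)) ∧
      ∃ K : ℝ, 0 < K ∧ ∃ lam : ℝ, 0 < lam ∧ ∀ t ≥ (0 : ℝ),
        |w t| ≤ K * Real.exp (-lam * t) ∧
        |φ t| ≤ K * Real.exp (-lam * t) ∧
        |α t| ≤ K * Real.exp (-lam * t) := by
  have hd0 : 0 < d := by rw [hd]; positivity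
  have hD0 : 0 < D := by rw [hD]; positivity
  have hν : 0 < ν0 := by rw [hν0]; positivity
  have hb : 0 < ν3 := by rw [hν3]; positivity
  have hg : 0 < γ3 := by rw [hγ3]; positivity
  have hL : 0 < -lam2 := by rw [hl2, neg_mul, neg_neg]; positivity
  have hn : 0 < -ν1 := by rw [hν1, neg_mul, neg_div, neg_neg]; positivity
  refine tendsto_and_exp_decay_of_relaxation_system hg hL hν hb hn hr
    (fun t ht => (hw t ht).congr_deriv (by ring)) hφ
    (fun t ht => (hα t ht).congr_deriv (by ring)) hr0 (hφinit ▸ hφ0ne)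
end

section
/- For any real constants μ1 and μ2 and any differentiable functions p_x, p_y, w : ℝ → ℝ satisfying p_x'(t) = μ1·p_y(t)² + μ2·p_y(t)·w(t) and p_y'(t) = −μ1·p_x(t)·p_y(t) − μ2·p_x(t)·w(t) for all t, the quantity p_x(t)² + p_y(t)² is constant in t (i.e., equals p_x(0)² + p_y(0)² for all t). -/
/-- Conservation of `p_x² + p_y²` along the reduced momentum dynamics. -/
theorem momentum_norm_conserved
    (μ1 μ2 : ℝ) (px py w : ℝ → ℝ)
    (hwdiff : Differentiable ℝ w)
    (hpx : ∀ t : ℝ, HasDerivAt px (μ1 * (py t) ^ 2 + μ2 * py t * w t) t)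
    (hpy : ∀ t : ℝ, HasDerivAt py (-(μ1 * px t * py t) - μ2 * px t * w t) t) :
    ∀ t : ℝ, (px t) ^ 2 + (py t) ^ 2 = (px 0) ^ 2 + (py 0) ^ 2 := by
  have hderiv : ∀ t : ℝ, HasDerivAt (fun s => px s ^ 2 + py s ^ 2) 0 t := fun t =>
    (((hpx t).fun_pow 2).fun_add ((hpy t).fun_pow 2)).congr_deriv (by push_cast; ring)
  exact fun t => is_const_of_deriv_eq_zero (fun s => (hderiv s).differentiableAt)
    (fun s => (hderiv s).deriv) t 0
end

section
/- Consider the restricted reduced Chaplygin-beanie dynamics and let (r, w, φ, α) : ℝ → ℝ⁴ be a differentiable solution. Then: (i) r is monotone nondecreasing, and r'(t) > 0 at every time t with w(t) ≠ 0; (ii) if r is constant on some nontrivial open interval I, then w(t) = 0, φ(t) = 0, and α(t) = 0 for all t ∈ I. In particular, r strictly increases unless the trajectory remains on the r-axis {(r, 0, 0, 0)}. -/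
open Real Set

/-- A function that is constant on an open interval has zero derivative there. -/
theorem HasDerivAt.eq_zero_of_forall_mem_Ioo_eq {f : ℝ → ℝ} {f' s t c u : ℝ}
    (hf : HasDerivAt f f' u) (hu : u ∈ Ioo s t) (hc : ∀ v ∈ Ioo s t, f v = c) : f' = 0 :=
  hf.unique <| (hasDerivAt_const u c).congr_of_eventuallyEq <|
    Filter.eventually_of_mem (isOpen_Ioo.mem_nhds hu) hc

/-- Along the restricted reduced Chaplygin-beanie dynamics, `r` is monotone
nondecreasing with strictly positive derivative wherever `w ≠ 0`, and if `r` is constant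
on a nontrivial open interval then `w`, `φ`, `α` vanish there. -/
theorem chaplygin_r_monotone_and_constancy
    (m M a B C k : ℝ)
    (hm : 0 < m) (hM : 0 < M) (ha : 0 < a) (hB : 0 < B) (hC : 0 < C) (hk : 0 < k)
    (d γ3 lam2 ν0 D ν1 ν3 : ℝ)
    (hd : d = m * (B + C) + M * (m * a ^ 2 + B + C))
    (hγ3 : γ3 = m * M * a * (m + M) / d)
    (hlam2 : lam2 = -a * (m + M))
    (hν0 : ν0 = B / d)
    (hD : D = B * (m * M * a ^ 2 + C * (m + M)))
    (hν1 : ν1 = -d * k / D)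
    (hν3 : ν3 = a * B * (m + M) ^ 2 / (d * D))
    (r w φ α : ℝ → ℝ)
    (hr : ∀ t : ℝ, HasDerivAt r (γ3 * (w t) ^ 2) t)
    (hw : ∀ t : ℝ,
      HasDerivAt w (lam2 * r t * w t - ν0 * (ν1 * φ t + ν3 * r t * w t)) t)
    (hφ : ∀ t : ℝ, HasDerivAt φ (α t) t)
    (hα : ∀ t : ℝ, HasDerivAt α (ν1 * φ t + ν3 * r t * w t) t) :
    Monotone r ∧
      (∀ t : ℝ, w t ≠ 0 → 0 < deriv r t) ∧
      (∀ s t c : ℝ, s < t → (∀ u ∈ Ioo s t, r u = c) →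
        ∀ u ∈ Ioo s t, w u = 0 ∧ φ u = 0 ∧ α u = 0) := by
  have hd0 : 0 < d := by rw [hd]; positivity
  have hD0 : 0 < D := by rw [hD]; positivity
  have hγ0 : 0 < γ3 := by rw [hγ3]; positivity
  have hν00 : ν0 ≠ 0 := by rw [hν0]; positivity
  have hν10 : ν1 ≠ 0 := by
    rw [hν1]
    exact div_ne_zero (mul_ne_zero (neg_ne_zero.mpr hd0.ne') hk.ne') hD0.ne'
  refine ⟨?_, fun t ht => ?_, fun s t c _ hc => ?_⟩
  · refine monotone_of_deriv_nonneg (fun t => (hr t).differentiableAt) fun t => ?_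
    rw [(hr t).deriv]
    positivity
  · rw [(hr t).deriv]
    positivity
  · have hw0 : ∀ u ∈ Ioo s t, w u = 0 := fun u hu => by
      simpa [hγ0.ne'] using (hr u).eq_zero_of_forall_mem_Ioo_eq hu hc
    have hφ0 : ∀ u ∈ Ioo s t, φ u = 0 := fun u hu => by
      simpa [hw0 u hu, hν00, hν10] using (hw u).eq_zero_of_forall_mem_Ioo_eq hu hw0
    exact fun u hu => ⟨hw0 u hu, hφ0 u hu, (hφ u).eq_zero_of_forall_mem_Ioo_eq hu hφ0⟩
end

section
/- For every r_c > 0, every complex number z satisfying z³ + (ν0·ν3 − λ2)·r_c·z² − ν1·z + λ2·ν1·r_c = 0 has strictly negative real part. That is, the characteristic polynomial of the linearization of the restricted reduced Chaplygin-beanie dynamics at any equilibrium (r_c, 0, 0, 0) with r_c > 0 is Hurwitz. -/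
open Complex

/-- Routh–Hurwitz criterion for real monic cubics (sufficiency). -/
theorem re_neg_of_cubic_eq_zero {p q r : ℝ} (hp : 0 < p) (hr : 0 < r) (hpq : r < p * q)
    {z : ℂ} (hz : z ^ 3 + (p : ℂ) * z ^ 2 + (q : ℂ) * z + (r : ℂ) = 0) : z.re < 0 := by
  have hq : 0 < q := pos_of_mul_pos_right (hr.trans hpq) hp.le
  obtain ⟨x, y⟩ := z
  have hre := congrArg Complex.re hz
  have him := congrArg Complex.im hz
  simp only [pow_succ, pow_zero, one_mul, add_re, add_im, mul_re, mul_im, ofReal_re, ofReal_im,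
    zero_re, zero_im] at hre him
  by_contra! hx
  change 0 ≤ x at hx
  have hy : y * (3 * x ^ 2 - y ^ 2 + 2 * p * x + q) = 0 := by linear_combination him
  rcases mul_eq_zero.mp hy with rfl | hy
  · have : 0 < x ^ 3 + p * x ^ 2 + q * x + r := by positivity
    linarith
  · have hpos : 0 ≤ 8 * x ^ 3 + 8 * p * x ^ 2 + 2 * q * x + 2 * p ^ 2 * x := by positivity
    have : 8 * x ^ 3 + 8 * p * x ^ 2 + 2 * q * x + 2 * p ^ 2 * x + p * q - r = 0 := by
      linear_combination (3 * x + p) * hy - hre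
    linarith

/-- The characteristic polynomial of the linearization of the restricted
reduced Chaplygin-beanie dynamics at an equilibrium `(r_c, 0, 0, 0)` with `r_c > 0`
is Hurwitz: every complex root has strictly negative real part. -/
theorem chaplygin_char_poly_hurwitz
    (m M a B C k : ℝ)
    (hm : 0 < m) (hM : 0 < M) (ha : 0 < a) (hB : 0 < B) (hC : 0 < C) (hk : 0 < k)
    (d lam2 ν0 D ν1 ν3 : ℝ)
    (hd : d = m * (B + C) + M * (m * a ^ 2 + B + C))
    (hlam2 : lam2 = -a * (m + M))
    (hν0 : ν0 = B / d)
    (hD : D = B * (m * M * a ^ 2 + C * (m + M)))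
    (hν1 : ν1 = -d * k / D)
    (hν3 : ν3 = a * B * (m + M) ^ 2 / (d * D))
    (rc : ℝ) (hrc : 0 < rc) :
    ∀ z : ℂ,
      z ^ 3 + (((ν0 * ν3 - lam2) * rc : ℝ) : ℂ) * z ^ 2 - ((ν1 : ℝ) : ℂ) * z
          + ((lam2 * ν1 * rc : ℝ) : ℂ) = 0 →
        z.re < 0 := by
  intro z hz
  have hd_pos : 0 < d := by rw [hd]; positivity
  have hD_pos : 0 < D := by rw [hD]; positivity
  have hν0_pos : 0 < ν0 := by rw [hν0]; positivity
  have hν3_pos : 0 < ν3 := by rw [hν3]; positivity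
  have hν1_neg : 0 < -ν1 := by
    rw [hν1, neg_mul, neg_div, neg_neg]
    positivity
  have hlam2_neg : 0 < -lam2 := by
    rw [hlam2, neg_mul, neg_neg]
    positivity
  have hr : 0 < -lam2 * -ν1 * rc := by positivity
  have hgap : 0 < ν0 * ν3 * rc * -ν1 := by positivity
  refine re_neg_of_cubic_eq_zero (p := (ν0 * ν3 - lam2) * rc) (q := -ν1) (r := lam2 * ν1 * rc)
    ?_ ?_ ?_ ?_
  · rw [sub_eq_add_neg]
    positivity
  · linarith
  · linarith
  · push_cast at hz ⊢
    linear_combination hz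
end

section
/- For every r_c > 0, every complex eigenvalue of the real 3×3 matrix Λ with rows ((λ2 − ν0·ν3)·r_c, −ν0·ν1, 0), (0, 0, 1), (ν3·r_c, ν1, 0) has strictly negative real part. -/
open Matrix

/-- The Routh–Hurwitz criterion for real monic cubics. -/
theorem Complex.re_neg_of_cubic_eq_zero {a₂ a₁ a₀ : ℝ} (h₂ : 0 < a₂) (h₁ : 0 < a₁) (h₀ : 0 < a₀)
    (h : a₀ < a₂ * a₁) {z : ℂ} (hz : z ^ 3 + a₂ * z ^ 2 + a₁ * z + a₀ = 0) : z.re < 0 := by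
  obtain ⟨x, y⟩ := z
  have hre := congrArg Complex.re hz
  have him := congrArg Complex.im hz
  simp [pow_succ] at hre him
  by_contra! hx
  change 0 ≤ x at hx
  have hy : y * (3 * x ^ 2 - y ^ 2 + 2 * a₂ * x + a₁) = 0 := by linear_combination him
  rcases mul_eq_zero.mp hy with rfl | hy
  · have : 0 < x ^ 3 + a₂ * x ^ 2 + a₁ * x + a₀ := by positivity
    linarith
  · have : 0 ≤ 8 * x ^ 3 + 8 * a₂ * x ^ 2 + 2 * a₁ * x + 2 * a₂ ^ 2 * x := by positivity
    have : 8 * x ^ 3 + 8 * a₂ * x ^ 2 + 2 * a₁ * x + 2 * a₂ ^ 2 * x + (a₂ * a₁ - a₀) = 0 := by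
      linear_combination -hre + (3 * x + a₂) * hy
    linarith

theorem Matrix.det_sub_eq_zero_of_mem_spectrum {n K : Type*} [Fintype n] [DecidableEq n] [Field K]
    {A : Matrix n n K} {μ : K} (h : μ ∈ spectrum K A) :
    (algebraMap K (Matrix n n K) μ - A).det = 0 := by
  by_contra hne
  exact h ((Matrix.isUnit_iff_isUnit_det _).mpr (isUnit_iff_ne_zero.mpr hne))

/-- Every complex eigenvalue of the Jacobian `Λ` of the linearized
restricted reduced Chaplygin-beanie dynamics at the origin (with `r` frozen at
`r_c > 0`) has strictly negative real part. -/
theorem chaplygin_jacobian_eigenvalues_neg_re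
    (m M a B C k : ℝ)
    (hm : 0 < m) (hM : 0 < M) (ha : 0 < a) (hB : 0 < B) (hC : 0 < C) (hk : 0 < k)
    (d lam2 ν0 D ν1 ν3 : ℝ)
    (hd : d = m * (B + C) + M * (m * a ^ 2 + B + C))
    (hlam2 : lam2 = -a * (m + M))
    (hν0 : ν0 = B / d)
    (hD : D = B * (m * M * a ^ 2 + C * (m + M)))
    (hν1 : ν1 = -d * k / D)
    (hν3 : ν3 = a * B * (m + M) ^ 2 / (d * D))
    (rc : ℝ) (hrc : 0 < rc)
    (Λ : Matrix (Fin 3) (Fin 3) ℝ)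
    (hΛ : Λ = !![(lam2 - ν0 * ν3) * rc, -(ν0 * ν1), 0;
                 0, 0, 1;
                 ν3 * rc, ν1, 0]) :
    ∀ μ ∈ spectrum ℂ (Λ.map (Complex.ofReal ·)), μ.re < 0 := by
  intro μ hμ
  have hd_pos : 0 < d := by rw [hd]; positivity
  have hD_pos : 0 < D := by rw [hD]; positivity
  have hν0_pos : 0 < ν0 := by rw [hν0]; positivity
  have hν3_pos : 0 < ν3 := by rw [hν3]; positivity
  have hν1_neg : 0 < -ν1 := by
    rw [hν1, neg_mul, neg_div, neg_neg]; positivity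
  have hlam2_neg : 0 < -lam2 := by
    rw [hlam2, neg_mul, neg_neg]; positivity
  have hdet := Matrix.det_sub_eq_zero_of_mem_spectrum hμ
  rw [hΛ, Matrix.det_fin_three] at hdet
  simp [Matrix.algebraMap_matrix_apply] at hdet
  refine Complex.re_neg_of_cubic_eq_zero (a₂ := (-lam2 + ν0 * ν3) * rc) (a₁ := -ν1)
    (a₀ := -lam2 * -ν1 * rc) (by positivity) hν1_neg (by positivity) ?_ ?_
  · have : 0 < ν0 * ν3 * -ν1 * rc := by positivity
    linarith
  · push_cast
    linear_combination hdet
end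

section
/- Fix r_c > 0 and let Λ be the real 3×3 matrix with rows ((λ2 − ν0·ν3)·r_c, −ν0·ν1, 0), (0, 0, 1), (ν3·r_c, ν1, 0). Then every differentiable solution x : ℝ → ℝ³ of the linear system x'(t) = Λ·x(t) decays exponentially: there exist constants K > 0 and λ > 0 (depending on the parameters but not on the solution) such that ‖x(t)‖ ≤ K·exp(−λ·t)·‖x(0)‖ for all t ≥ 0. -/
open Matrix Real

/-- A differential inequality `f' ≤ -c f` forces exponential decay. -/
theorem le_exp_mul_of_hasDerivAt_le {f f' : ℝ → ℝ} {c : ℝ}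
    (hf : ∀ t, HasDerivAt f (f' t) t) (hle : ∀ t, f' t ≤ -c * f t) {t : ℝ} (ht : 0 ≤ t) :
    f t ≤ Real.exp (-c * t) * f 0 := by
  have hg : ∀ t, HasDerivAt (fun t => Real.exp (c * t) * f t)
      (Real.exp (c * t) * (c * 1) * f t + Real.exp (c * t) * f' t) t := fun t =>
    (((hasDerivAt_id t).const_mul c).exp).mul (hf t)
  have hanti : Antitone fun t => Real.exp (c * t) * f t := by
    refine antitone_of_deriv_nonpos (fun t => (hg t).differentiableAt) fun t => ?_
    rw [(hg t).deriv]
    nlinarith [mul_le_mul_of_nonneg_left (hle t) (Real.exp_pos (c * t)).le]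
  have h := mul_le_mul_of_nonneg_left (hanti ht) (Real.exp_pos (-c * t)).le
  rw [← mul_assoc, ← Real.exp_add] at h
  simpa using h

theorem sq_norm_fin_three_le (v : Fin 3 → ℝ) :
    ‖v‖ ^ 2 ≤ v 0 ^ 2 + v 1 ^ 2 + v 2 ^ 2 := by
  have h : ‖v‖ ≤ √(v 0 ^ 2 + v 1 ^ 2 + v 2 ^ 2) := by
    refine (pi_norm_le_iff_of_nonneg (Real.sqrt_nonneg _)).2 fun i => ?_
    refine Real.abs_le_sqrt ?_
    fin_cases i <;> dsimp only [Fin.mk_one, Fin.zero_eta, Fin.reduceFinMk] <;>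
      linarith [sq_nonneg (v 0), sq_nonneg (v 1), sq_nonneg (v 2)]
  calc ‖v‖ ^ 2 ≤ √(v 0 ^ 2 + v 1 ^ 2 + v 2 ^ 2) ^ 2 := by gcongr
    _ = _ := Real.sq_sqrt (by positivity)

theorem sum_sq_fin_three_le (v : Fin 3 → ℝ) :
    v 0 ^ 2 + v 1 ^ 2 + v 2 ^ 2 ≤ 3 * ‖v‖ ^ 2 := by
  have h (i : Fin 3) : v i ^ 2 ≤ ‖v‖ ^ 2 := sq_le_sq' (neg_le_of_abs_le (norm_le_pi_norm v i))
    (le_of_abs_le (norm_le_pi_norm v i))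
  linarith [h 0, h 1, h 2]

/-- Lyapunov's criterion in `ℝ³`, in terms of the sum of squares of the coordinates. -/
theorem exists_exp_decay_of_lyapunov (A : Matrix (Fin 3) (Fin 3) ℝ) (V V' : (Fin 3 → ℝ) → ℝ)
    {c₁ c₂ c₃ : ℝ} (h₁ : 0 < c₁) (h₂ : 0 < c₂) (h₃ : 0 < c₃)
    (hlow : ∀ v, c₁ * (v 0 ^ 2 + v 1 ^ 2 + v 2 ^ 2) ≤ V v)
    (hup : ∀ v, V v ≤ c₂ * (v 0 ^ 2 + v 1 ^ 2 + v 2 ^ 2))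
    (hdec : ∀ v, V' v ≤ -c₃ * (v 0 ^ 2 + v 1 ^ 2 + v 2 ^ 2))
    (hderiv : ∀ x : ℝ → (Fin 3 → ℝ), (∀ t : ℝ, HasDerivAt x (A.mulVec (x t)) t) →
      ∀ t, HasDerivAt (fun t => V (x t)) (V' (x t)) t) :
    ∃ K : ℝ, 0 < K ∧ ∃ lam : ℝ, 0 < lam ∧
      ∀ x : ℝ → (Fin 3 → ℝ),
        (∀ t : ℝ, HasDerivAt x (A.mulVec (x t)) t) →
        ∀ t : ℝ, 0 ≤ t → ‖x t‖ ≤ K * Real.exp (-lam * t) * ‖x 0‖ := by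
  refine ⟨√(3 * c₂ / c₁), by positivity, c₃ / c₂ / 2, by positivity, fun x hx t ht => ?_⟩
  have hle (v : Fin 3 → ℝ) : V' v ≤ -(c₃ / c₂) * V v := by
    refine (hdec v).trans ?_
    have h := mul_le_mul_of_nonneg_left (hup v) (div_pos h₃ h₂).le
    rw [← mul_assoc, div_mul_cancel₀ _ h₂.ne'] at h
    linarith
  have hV := le_exp_mul_of_hasDerivAt_le (hderiv x hx) (fun t => hle (x t)) ht
  have hexp : Real.exp (-(c₃ / c₂) * t) = Real.exp (-(c₃ / c₂ / 2) * t) ^ 2 := by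
    rw [← Real.exp_nat_mul]
    congr 1
    push_cast
    ring
  refine (sq_le_sq₀ (norm_nonneg _) (by positivity)).1 ?_
  rw [mul_pow, mul_pow, Real.sq_sqrt (by positivity), ← hexp, div_mul_eq_mul_div,
    div_mul_eq_mul_div, le_div_iff₀ h₁]
  calc ‖x t‖ ^ 2 * c₁ = c₁ * ‖x t‖ ^ 2 := mul_comm _ _
    _ ≤ c₁ * (x t 0 ^ 2 + x t 1 ^ 2 + x t 2 ^ 2) := by
      gcongr
      exact sq_norm_fin_three_le _
    _ ≤ V (x t) := hlow _
    _ ≤ Real.exp (-(c₃ / c₂) * t) * V (x 0) := hV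
    _ ≤ Real.exp (-(c₃ / c₂) * t) * (c₂ * (3 * ‖x 0‖ ^ 2)) := by
      gcongr
      exact (hup _).trans (by gcongr; exact sum_sq_fin_three_le _)
    _ = _ := by ring

/-- The linear system `w' = -(b + n U) w + n N φ`, `φ' = α`, `α' = U w - N φ` decays
exponentially. The Lyapunov function is the energy `U / (b n) (w + n α)² + α² + N φ²`, whose
derivative is `-(2 U / n) w²`, plus a small multiple of `-w φ - (n / 2) φ α`. -/
theorem exists_exp_decay_of_pos {b n U N : ℝ} (hb : 0 < b) (hn : 0 < n) (hU : 0 < U)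
    (hN : 0 < N) :
    ∃ K : ℝ, 0 < K ∧ ∃ lam : ℝ, 0 < lam ∧
      ∀ x : ℝ → (Fin 3 → ℝ),
        (∀ t : ℝ, HasDerivAt x
          ((!![-(b + n * U), n * N, 0; 0, 0, 1; U, -N, 0] : Matrix (Fin 3) (Fin 3) ℝ).mulVec
            (x t)) t) →
        ∀ t : ℝ, 0 ≤ t → ‖x t‖ ≤ K * Real.exp (-lam * t) * ‖x 0‖ := by
  obtain ⟨c, hc, hcb⟩ : ∃ c : ℝ, 0 < c ∧ c * b * n = U :=
    ⟨U / (b * n), by positivity, by field_simp⟩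
  obtain ⟨H, hH, hHdef⟩ : ∃ H : ℝ, 0 < H ∧ H = 2 / c + 1 + 2 * n ^ 2 + 1 / N :=
    ⟨_, by positivity, rfl⟩
  obtain ⟨R, hR⟩ : ∃ R : ℝ, R = b + n * U - n * U / 2 := ⟨_, rfl⟩
  obtain ⟨S, hS, hSdef⟩ : ∃ S : ℝ, 0 < S ∧ S = R ^ 2 / (n * N) + 1 / n :=
    ⟨_, by positivity, rfl⟩
  obtain ⟨δ, hδ, hδ₁, hδ₂⟩ : ∃ δ : ℝ, 0 < δ ∧ δ ≤ n * N / 4 ∧ δ ≤ n / 4 :=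
    ⟨min (n * N / 4) (n / 4), by positivity, min_le_left _ _, min_le_right _ _⟩
  obtain ⟨ε, hε, hε₁, hε₂⟩ : ∃ ε : ℝ, 0 < ε ∧ ε * (S + δ) ≤ 2 * c * b ∧
      ε * (1 + n) ≤ 1 / (2 * H) :=
    ⟨min (2 * c * b / (S + δ)) (1 / (2 * H) / (1 + n)), by positivity,
      (le_div_iff₀ (by positivity)).1 (min_le_left _ _),
      (le_div_iff₀ (by positivity)).1 (min_le_right _ _)⟩
  have hcross (w p q : ℝ) : |-(w * p) - n / 2 * (p * q)| ≤ (1 + n) * (w ^ 2 + p ^ 2 + q ^ 2) := by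
    rw [abs_le]
    constructor <;>
    nlinarith [sq_nonneg (w + p), sq_nonneg (w - p), mul_nonneg hn.le (sq_nonneg (p + q)),
      mul_nonneg hn.le (sq_nonneg (p - q)), mul_nonneg hn.le (sq_nonneg w),
      mul_nonneg hn.le (sq_nonneg p), mul_nonneg hn.le (sq_nonneg q), sq_nonneg q, sq_nonneg w]
  have hcrossε (w p q : ℝ) :
      |ε * (-(w * p) - n / 2 * (p * q))| ≤ 1 / (2 * H) * (w ^ 2 + p ^ 2 + q ^ 2) := by
    rw [abs_mul, abs_of_pos hε]
    calc _ ≤ ε * ((1 + n) * (w ^ 2 + p ^ 2 + q ^ 2)) := by gcongr; exact hcross w p q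
      _ = ε * (1 + n) * (w ^ 2 + p ^ 2 + q ^ 2) := by ring
      _ ≤ _ := by gcongr
  have henergy (w p q : ℝ) : 1 / H * (w ^ 2 + p ^ 2 + q ^ 2) ≤
      c * (w + n * q) ^ 2 + q ^ 2 + N * p ^ 2 := by
    rw [one_div_mul_eq_div, div_le_iff₀ hH]
    have h₁ : w ^ 2 ≤ 2 * (w + n * q) ^ 2 + 2 * n ^ 2 * q ^ 2 := by
      nlinarith [sq_nonneg (w + 2 * n * q)]
    have h₂ : 2 * (w + n * q) ^ 2 = c * (w + n * q) ^ 2 * (2 / c) := by field_simp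
    have h₃ : p ^ 2 = N * p ^ 2 * (1 / N) := by field_simp
    have e : ∀ X Y Z i j : ℝ, 0 ≤ X → 0 ≤ Y → 0 ≤ Z → 0 ≤ i → 0 ≤ j →
        X * i + (1 + 2 * n ^ 2) * Y + Z * j ≤ (X + Y + Z) * (i + 1 + 2 * n ^ 2 + j) := by
      intro X Y Z i j hX hY hZ hi hj
      have : 0 ≤ X * (1 + 2 * n ^ 2 + j) + Y * (i + j) + Z * (i + 1 + 2 * n ^ 2) := by
        positivity
      linarith
    have h₄ := e (c * (w + n * q) ^ 2) (q ^ 2) (N * p ^ 2) (2 / c) (1 / N) (by positivity)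
      (by positivity) (by positivity) (by positivity) (by positivity)
    rw [hHdef]
    linarith
  refine exists_exp_decay_of_lyapunov _
    (fun v => c * (v 0 + n * v 2) ^ 2 + v 2 ^ 2 + N * v 1 ^ 2 +
      ε * (-(v 0 * v 1) - n / 2 * (v 1 * v 2)))
    (fun v => -(2 * c * b) * v 0 ^ 2 + ε * (R * (v 0 * v 1) - v 0 * v 2 -
      n * N / 2 * v 1 ^ 2 - n / 2 * v 2 ^ 2))
    (c₁ := 1 / (2 * H)) (c₂ := 2 * c + 2 * c * n ^ 2 + 1 + N + 1 / (2 * H)) (c₃ := ε * δ)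
    (by positivity) (by positivity) (by positivity) (fun v => ?_) (fun v => ?_) (fun v => ?_) ?_
  · have h := neg_le_of_abs_le (hcrossε (v 0) (v 1) (v 2))
    have h' := henergy (v 0) (v 1) (v 2)
    have hH2 : 1 / H = 2 * (1 / (2 * H)) := by field_simp
    rw [hH2] at h'
    linarith
  · have h := le_of_abs_le (hcrossε (v 0) (v 1) (v 2))
    have h₁ : 0 ≤ c * (v 0 - n * v 2) ^ 2 := by positivity
    have h₂ : 0 ≤ (2 * c + 2 * c * n ^ 2 + 1) * v 1 ^ 2 + (2 * c + N) * v 2 ^ 2 +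
      (2 * c * n ^ 2 + 1 + N) * v 0 ^ 2 := by positivity
    linarith
  · have h₁ : R * (v 0 * v 1) ≤ R ^ 2 / (n * N) * v 0 ^ 2 + n * N / 4 * v 1 ^ 2 := by
      have : 0 ≤ (n * N / 2 * v 1 - R * v 0) ^ 2 / (n * N) := by positivity
      have e : (n * N / 2 * v 1 - R * v 0) ^ 2 / (n * N) =
        R ^ 2 / (n * N) * v 0 ^ 2 + n * N / 4 * v 1 ^ 2 - R * (v 0 * v 1) := by
        field_simp
        ring
      linarith
    have h₂ : -(v 0 * v 2) ≤ 1 / n * v 0 ^ 2 + n / 4 * v 2 ^ 2 := by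
      have : 0 ≤ (n / 2 * v 2 + v 0) ^ 2 / n := by positivity
      have e : (n / 2 * v 2 + v 0) ^ 2 / n =
        1 / n * v 0 ^ 2 + n / 4 * v 2 ^ 2 + v 0 * v 2 := by
        field_simp
        ring
      linarith
    have h₃ : R * (v 0 * v 1) - v 0 * v 2 - n * N / 2 * v 1 ^ 2 - n / 2 * v 2 ^ 2 ≤
        S * v 0 ^ 2 - δ * v 1 ^ 2 - δ * v 2 ^ 2 := by
      rw [hSdef]
      linarith [mul_le_mul_of_nonneg_right hδ₁ (sq_nonneg (v 1)),
        mul_le_mul_of_nonneg_right hδ₂ (sq_nonneg (v 2))]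
    have h₄ := mul_le_mul_of_nonneg_left h₃ hε.le
    have h₅ := mul_le_mul_of_nonneg_right hε₁ (sq_nonneg (v 0))
    linarith
  · intro x hx t
    have hxi := hasDerivAt_pi.1 (hx t)
    have hw := hxi 0
    have hp := hxi 1
    have hq := hxi 2
    simp only [Matrix.mulVec, dotProduct, Fin.sum_univ_three, Matrix.of_apply, Matrix.cons_val,
      Matrix.cons_val_zero, Matrix.cons_val_one] at hw hp hq
    have h := (((((hw.add (hq.const_mul n)).pow 2).const_mul c).add (hq.pow 2)).add
      ((hp.pow 2).const_mul N)).add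
      (((hw.mul hp).neg.sub ((hp.mul hq).const_mul (n / 2))).const_mul ε)
    refine h.congr_deriv ?_
    simp only [Pi.add_apply]
    subst hcb hR
    push_cast
    ring

/-- Every solution of the linearized restricted reduced Chaplygin-beanie
dynamics `x' = Λ x` (with `r` frozen at `r_c > 0`) decays exponentially. -/
theorem chaplygin_linearized_exponential_decay
    (m M a B C k : ℝ)
    (hm : 0 < m) (hM : 0 < M) (ha : 0 < a) (hB : 0 < B) (hC : 0 < C) (hk : 0 < k)
    (d lam2 ν0 D ν1 ν3 : ℝ)
    (hd : d = m * (B + C) + M * (m * a ^ 2 + B + C))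
    (hlam2 : lam2 = -a * (m + M))
    (hν0 : ν0 = B / d)
    (hD : D = B * (m * M * a ^ 2 + C * (m + M)))
    (hν1 : ν1 = -d * k / D)
    (hν3 : ν3 = a * B * (m + M) ^ 2 / (d * D))
    (rc : ℝ) (hrc : 0 < rc)
    (Λ : Matrix (Fin 3) (Fin 3) ℝ)
    (hΛ : Λ = !![(lam2 - ν0 * ν3) * rc, -(ν0 * ν1), 0;
                 0, 0, 1;
                 ν3 * rc, ν1, 0]) :
    ∃ K : ℝ, 0 < K ∧ ∃ lam : ℝ, 0 < lam ∧
      ∀ x : ℝ → (Fin 3 → ℝ),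
        (∀ t : ℝ, HasDerivAt x (Λ.mulVec (x t)) t) →
        ∀ t : ℝ, 0 ≤ t → ‖x t‖ ≤ K * Real.exp (-lam * t) * ‖x 0‖ := by
  have hdpos : 0 < d := by rw [hd]; positivity
  have hDpos : 0 < D := by rw [hD]; positivity
  have hU : 0 < ν3 * rc := by rw [hν3]; positivity
  have hn : 0 < ν0 := by rw [hν0]; positivity
  have hN : 0 < -ν1 := by
    rw [hν1, neg_mul, neg_div, neg_neg]
    positivity
  have hb : 0 < -lam2 * rc := by
    rw [hlam2, neg_mul a, neg_neg]
    positivity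
  have hΛ' : Λ = !![-(-lam2 * rc + ν0 * (ν3 * rc)), ν0 * -ν1, 0;
      0, 0, 1; ν3 * rc, - -ν1, 0] := by
    rw [hΛ, neg_neg, mul_neg]
    congr! 3
    ring
  rw [hΛ']
  exact exists_exp_decay_of_pos hb hn hU hN
end

section
/- Let B1, B2, Θ, φ, ψ be real numbers with B1 ≠ 0, B2 ≠ 0, sin(φ) ≠ 0, Θ > 0, and ψ ∈ (−π, π), and define a1 = Θ·sin(φ − ψ)/(B1·sin(φ)) and a2 = Θ·sin(ψ)/(B2·sin(φ)). Then the argument of the complex number (a1·B1 + a2·B2·cos(φ)) + (−a2·B2·sin(φ))·i equals −ψ; equivalently, ψ = −atan2(−a2·B2·sin(φ), a1·B1 + a2·B2·cos(φ)). -/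
open Real

/-- the harmonic-balance coefficients satisfy the phase equation
`ψ = −atan2(−a2·B2·sin φ, a1·B1 + a2·B2·cos φ)`, expressed via the complex argument. -/
theorem harmonic_balance_phase_equation
    (B1 B2 Θ φ ψ a1 a2 : ℝ)
    (hB1 : B1 ≠ 0) (hB2 : B2 ≠ 0) (hsin : sin φ ≠ 0)
    (hΘ : 0 < Θ) (hψ : ψ ∈ Set.Ioo (-π) π)
    (ha1 : a1 = Θ * sin (φ - ψ) / (B1 * sin φ))
    (ha2 : a2 = Θ * sin ψ / (B2 * sin φ)) :
    Complex.arg (((a1 * B1 + a2 * B2 * cos φ : ℝ) : ℂ)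
        + ((-(a2 * B2 * sin φ) : ℝ) : ℂ) * Complex.I) = -ψ := by
  have hre : a1 * B1 + a2 * B2 * cos φ = Θ * cos (-ψ) := by
    rw [ha1, ha2, sin_sub, cos_neg]
    field_simp
    ring
  have him : -(a2 * B2 * sin φ) = Θ * sin (-ψ) := by
    rw [ha2, sin_neg]
    field_simp
  have hmem : -ψ ∈ Set.Ioc (-π) π :=
    ⟨neg_lt_neg hψ.2, (neg_lt.mp hψ.1).le⟩
  rw [hre, him]
  convert Complex.arg_mul_cos_add_sin_mul_I hΘ hmem using 2
  push_cast
  ring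
end

section
/- The three no-slip wheel constraint functions of the three-link wheeled snake robot are invariant under the lifted left action of SE(2): for all real (u1, u2, β), all configurations (x, y, θ, α1, α2), and all velocities (ẋ, ẏ, θ̇, α̇1, α̇2), each constraint value c_i = −ẋ_i·sin(θ_i) + ẏ_i·cos(θ_i) (i = 1, 2, 3) computed from the transformed configuration (u1 + x·cos β − y·sin β, u2 + y·cos β + x·sin β, θ + β, α1, α2) and transformed velocity (ẋ·cos β − ẏ·sin β, ẋ·sin β + ẏ·cos β, θ̇, α̇1, α̇2) equals the constraint value computed from the original configuration and velocity. -/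
open Real

/-- The three no-slip wheel constraint values `(c₁, c₂, c₃)` of the three-link wheeled
snake robot, computed from the configuration `(x, y, θ, α1, α2)` and the velocity
`(dx, dy, dθ, dα1, dα2)` via the recursive link kinematics. -/
noncomputable def snakeConstraints (R x y θ α1 α2 dx dy dθ dα1 dα2 : ℝ) : ℝ × ℝ × ℝ :=
  let θ1 := θ
  let θ2 := θ + α1
  let θ3 := θ + α1 + α2
  let dθ1 := dθ
  let dθ2 := dθ + dα1
  let dθ3 := dθ + dα1 + dα2
  let x1 := x
  let y1 := y
  let dx1 := dx
  let dy1 := dy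
  let x2 := x1 + (R/2) * (cos θ1 + cos θ2)
  let y2 := y1 + (R/2) * (sin θ1 + sin θ2)
  let dx2 := dx1 - (R/2) * (sin θ1 * dθ1 + sin θ2 * dθ2)
  let dy2 := dy1 + (R/2) * (cos θ1 * dθ1 + cos θ2 * dθ2)
  let x3 := x2 + (R/2) * (cos θ2 + cos θ3)
  let y3 := y2 + (R/2) * (sin θ2 + sin θ3)
  let dx3 := dx2 - (R/2) * (sin θ2 * dθ2 + sin θ3 * dθ3)
  let dy3 := dy2 + (R/2) * (cos θ2 * dθ2 + cos θ3 * dθ3)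
  (-dx1 * sin θ1 + dy1 * cos θ1,
   -dx2 * sin θ2 + dy2 * cos θ2,
   -dx3 * sin θ3 + dy3 * cos θ3)

/-- The lateral velocity of a wheel is unchanged when its velocity and heading are rotated by the
same angle. -/
lemma lateral_velocity_rotate (a b t β : ℝ) :
    -(a * cos β - b * sin β) * sin (t + β) + (a * sin β + b * cos β) * cos (t + β)
      = -a * sin t + b * cos t := by
  rw [sin_add, cos_add]
  linear_combination (-a * sin t + b * cos t) * sin_sq_add_cos_sq β

/-- The three no-slip wheel constraint functions of the three-link wheeled
snake robot are invariant under the lifted left action of `SE(2)`. -/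
theorem snake_constraints_se2_invariant
    (R : ℝ) (hR : 0 < R) (u1 u2 β : ℝ)
    (x y θ α1 α2 dx dy dθ dα1 dα2 : ℝ) :
    snakeConstraints R
        (u1 + x * cos β - y * sin β) (u2 + y * cos β + x * sin β) (θ + β) α1 α2
        (dx * cos β - dy * sin β) (dx * sin β + dy * cos β) dθ dα1 dα2
      = snakeConstraints R x y θ α1 α2 dx dy dθ dα1 dα2 := by
  have h2 : θ + β + α1 = θ + α1 + β := by ring
  have h3 : θ + α1 + β + α2 = θ + α1 + α2 + β := by ring
  simp only [snakeConstraints, h2, h3, Prod.mk.injEq]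
  refine ⟨lateral_velocity_rotate .., ?_, ?_⟩
  · rw [← lateral_velocity_rotate _ _ (θ + α1) β]
    congr 2 <;> simp only [sin_add _ β, cos_add _ β] <;> ring
  · rw [← lateral_velocity_rotate _ _ (θ + α1 + α2) β]
    congr 2 <;> simp only [sin_add _ β, cos_add _ β] <;> ring
end

section
/- The kinematic connection of the three-link wheeled snake robot solves its no-slip constraints: fix R > 0, joint angles (α1, α2) with D := (2/R)·(−sin α1 − sin(α1 − α2) + sin α2) ≠ 0, joint velocities (α̇1, α̇2), and any heading θ. Define the body velocities ξ_x = (1/D)·((cos α1 + cos(α1 − α2))·α̇1 + (1 + cos α1)·α̇2), ξ_y = 0, ξ_θ = (2/(R·D))·((sin α1 + sin(α1 − α2))·α̇1 + sin α1·α̇2), and the world velocities ẋ = ξ_x·cos θ − ξ_y·sin θ, ẏ = ξ_x·sin θ + ξ_y·cos θ, θ̇ = ξ_θ. Then all three wheel constraint functions vanish: c_i = −ẋ_i·sin(θ_i) + ẏ_i·cos(θ_i) = 0 for i = 1, 2, 3. -/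
open Real

/-- The kinematic connection of the three-link wheeled snake robot solves
its no-slip wheel constraints: the body velocities produced by the connection, pushed to
world velocities, annihilate all three wheel constraints. -/
theorem snake_connection_solves_constraints
    (R : ℝ) (hR : 0 < R)
    (x y θ α1 α2 dα1 dα2 : ℝ)
    (Dv ξx ξy ξθ dx dy dθ : ℝ)
    (hDv : Dv = (2 / R) * (-sin α1 - sin (α1 - α2) + sin α2))
    (hDne : Dv ≠ 0)
    (hξx : ξx = (1 / Dv) * ((cos α1 + cos (α1 - α2)) * dα1 + (1 + cos α1) * dα2))
    (hξy : ξy = 0)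
    (hξθ : ξθ = (2 / (R * Dv)) * ((sin α1 + sin (α1 - α2)) * dα1 + sin α1 * dα2))
    (hdx : dx = ξx * cos θ - ξy * sin θ)
    (hdy : dy = ξx * sin θ + ξy * cos θ)
    (hdθ : dθ = ξθ) :
    snakeConstraints R x y θ α1 α2 dx dy dθ dα1 dα2 = (0, 0, 0) := by
  set E := -sin α1 - sin (α1 - α2) + sin α2 with hE
  have hRne : R ≠ 0 := hR.ne'
  have hEne : E ≠ 0 := by
    intro h
    exact hDne (by rw [hDv, h, mul_zero])
  have hx : E * ξx = (R / 2) * ((cos α1 + cos (α1 - α2)) * dα1 + (1 + cos α1) * dα2) := by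
    rw [hξx, hDv]
    field_simp
  have hω : E * ξθ = (sin α1 + sin (α1 - α2)) * dα1 + sin α1 * dα2 := by
    rw [hξθ, hDv]
    field_simp
  have h1 := sin_sq_add_cos_sq α1
  have body2 : -ξx * sin α1 + R / 2 * ((1 + cos α1) * ξθ + dα1) = 0 := by
    apply (mul_eq_zero.mp _).resolve_left hEne
    rw [sin_sub] at hE hω
    rw [cos_sub] at hx
    linear_combination (-sin α1) * hx + R / 2 * (1 + cos α1) * hω + R / 2 * dα1 * hE
      - R / 2 * dα1 * sin α2 * h1
  have body3 : -ξx * sin (α1 + α2) + R / 2 * (cos (α1 + α2) * ξθ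
      + 2 * cos α2 * (ξθ + dα1) + (ξθ + dα1 + dα2)) = 0 := by
    apply (mul_eq_zero.mp _).resolve_left hEne
    rw [sin_sub] at hE hω
    rw [cos_sub] at hx
    rw [sin_add, cos_add]
    linear_combination (-(sin α1 * cos α2 + cos α1 * sin α2)) * hx
      + R / 2 * (cos α1 * cos α2 - sin α1 * sin α2 + 2 * cos α2 + 1) * hω
      + R / 2 * (2 * cos α2 * dα1 + dα1 + dα2) * hE
      - R / 2 * (dα1 * sin α2 + 2 * dα1 * sin α2 * cos α2 + dα2 * sin α2) * h1
  have h12 := sin_sq_add_cos_sq (θ + α1)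
  have h123 := sin_sq_add_cos_sq (θ + α1 + α2)
  have s1 : sin α1 = sin (θ + α1) * cos θ - cos (θ + α1) * sin θ := by
    rw [← sin_sub]; ring_nf
  have c1 : cos α1 = cos (θ + α1) * cos θ + sin (θ + α1) * sin θ := by
    rw [← cos_sub]; ring_nf
  have s12 : sin (α1 + α2) = sin (θ + α1 + α2) * cos θ - cos (θ + α1 + α2) * sin θ := by
    rw [← sin_sub]; ring_nf
  have c12 : cos (α1 + α2) = cos (θ + α1 + α2) * cos θ + sin (θ + α1 + α2) * sin θ := by
    rw [← cos_sub]; ring_nf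
  have c2 : cos α2 = cos (θ + α1 + α2) * cos (θ + α1) + sin (θ + α1 + α2) * sin (θ + α1) := by
    rw [← cos_sub]; ring_nf
  simp only [snakeConstraints, Prod.mk.injEq]
  rw [hdx, hdy, hdθ, hξy]
  refine ⟨by ring, ?_, ?_⟩
  · rw [s1, c1] at body2
    linear_combination body2 + R / 2 * (ξθ + dα1) * h12
  · rw [s12, c12, c2] at body3
    linear_combination body3 + R / 2 * (ξθ + dα1 + dα2) * h123
end
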